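/- arXiv:2108.08410 — 3 statements merged into one kernel-verified Lean document; each statement's English description precedes it below -/
import Mathlib

section
/- For integers r ≥ 2 and k_1 ≥ k_2 ≥ ⋯ ≥ k_r ≥ 2, M_r(k_1,…,k_r) ≤ ((k_1+k_2−2)(k_1+k_2−3)/((k_1−1)(k_2−1))) · multinomial(k_1+⋯+k_r−2r; k_1−2, k_2−2, …, k_r−2). -/
/-- Properties (i)–(iii) characterizing the main term `M_r` and the waste function `w_r`:
(i) `M_2(k₁,k₂) = C(k₁+k₂-2, k₁-1)` and `w_2(k₁,k₂) = 0`;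
(ii) both functions "ignore 2's": if a coordinate of an `(r+1)`-tuple equals `2`, the value
equals that of the `r`-tuple with that coordinate removed;
(iii) if all coordinates are at least `3`, `M_r` satisfies the multinomial-type recurrence and
`w_r` satisfies the same recurrence with an extra additive `r - 2`. -/
def MwProps (M w : ∀ r : ℕ, (Fin r → ℕ) → ℕ) : Prop :=
  (∀ k : Fin 2 → ℕ, (∀ i, 2 ≤ k i) →
      M 2 k = Nat.choose (k 0 + k 1 - 2) (k 0 - 1) ∧ w 2 k = 0) ∧
  (∀ r : ℕ, 2 ≤ r → ∀ k : Fin (r + 1) → ℕ, (∀ i, 2 ≤ k i) → ∀ i : Fin (r + 1), k i = 2 →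
      M (r + 1) k = M r (k ∘ i.succAbove) ∧ w (r + 1) k = w r (k ∘ i.succAbove)) ∧
  (∀ r : ℕ, 2 ≤ r → ∀ k : Fin r → ℕ, (∀ i, 3 ≤ k i) →
      M r k = ∑ i : Fin r, M r (Function.update k i (k i - 1)) ∧
      w r k = (∑ i : Fin r, w r (Function.update k i (k i - 1))) + (r - 2))

/-- The factor by which the bound on `M_r` exceeds the multinomial coefficient, as a function of
the two largest coordinates. -/
noncomputable def topFactor (x y : ℝ) : ℝ := (x + y - 2) * (x + y - 3) / ((x - 1) * (y - 1))

lemma topFactor_comm (x y : ℝ) : topFactor x y = topFactor y x := by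
  unfold topFactor
  rw [add_comm x y, mul_comm (x - 1)]

lemma topFactor_sub_one_left_le {x y : ℝ} (hx : 2 < x) (hy : 1 < y) (hyx : y ≤ x) :
    topFactor (x - 1) y ≤ topFactor x y := by
  unfold topFactor
  have hx1 : 0 < x - 1 - 1 := by linarith
  have hx2 : 0 < x - 1 := by linarith
  have hy1 : 0 < y - 1 := by linarith
  rw [div_le_div_iff₀ (by positivity) (by positivity)]
  have hs : 0 ≤ (x + y - 3) * (y - 1) * (x - y) :=
    mul_nonneg (mul_nonneg (by linarith) hy1.le) (by linarith)
  linear_combination hs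

lemma topFactor_recurrence {x y : ℝ} (hx : 2 < x) (hy : 2 < y) :
    (topFactor x y - topFactor (x - 1) y) * (x - 2) +
      (topFactor x y - topFactor x (y - 1)) * (y - 2) = 0 := by
  unfold topFactor
  have h1 : x - 1 - 1 ≠ 0 := by linarith
  have h2 : x - 1 ≠ 0 := by linarith
  have h3 : y - 1 - 1 ≠ 0 := by linarith
  have h4 : y - 1 ≠ 0 := by linarith
  field_simp
  ring

lemma sum_mul_multinomial_update_pred {r : ℕ} (a : Fin r → ℕ) (i : Fin r) (hi : 1 ≤ a i) :
    (∑ j, a j) * Nat.multinomial Finset.univ (Function.update a i (a i - 1)) =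
      a i * Nat.multinomial Finset.univ a := by
  set b := Function.update a i (a i - 1) with hb
  have hspec := Nat.multinomial_spec Finset.univ a
  have hspec' := Nat.multinomial_spec Finset.univ b
  have hsum : ∑ j, a j = ∑ j, b j + 1 := by
    rw [← Finset.add_sum_erase _ a (Finset.mem_univ i),
      ← Finset.add_sum_erase _ b (Finset.mem_univ i),
      Finset.sum_congr rfl (fun j hj => by
        rw [hb, Function.update_of_ne (Finset.ne_of_mem_erase hj)] :
        ∀ j ∈ Finset.univ.erase i, b j = a j), hb, Function.update_self]
    have : a i = a i - 1 + 1 := by omega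
    linarith
  have hprod : ∏ j, (a j).factorial = a i * ∏ j, (b j).factorial := by
    rw [← Finset.mul_prod_erase _ (fun j => (a j).factorial) (Finset.mem_univ i),
      ← Finset.mul_prod_erase _ (fun j => (b j).factorial) (Finset.mem_univ i),
      Finset.prod_congr rfl (fun j hj => by
        rw [hb, Function.update_of_ne (Finset.ne_of_mem_erase hj)] :
        ∀ j ∈ Finset.univ.erase i, (b j).factorial = (a j).factorial), hb, Function.update_self,
      ← mul_assoc, Nat.mul_factorial_pred (by omega)]
  have hpos : 0 < ∏ j, (b j).factorial := Finset.prod_pos fun j _ => Nat.factorial_pos _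
  refine Nat.eq_of_mul_eq_mul_left hpos ?_
  calc (∏ j, (b j).factorial) * ((∑ j, a j) * Nat.multinomial Finset.univ b)
      = (∑ j, a j) * ((∏ j, (b j).factorial) * Nat.multinomial Finset.univ b) := by ring
    _ = (∑ j, a j).factorial := by rw [hspec', hsum, Nat.factorial_succ]
    _ = (∏ j, (b j).factorial) * (a i * Nat.multinomial Finset.univ a) := by
      rw [← hspec, hprod]; ring

lemma multinomial_comp_succAbove {r : ℕ} (a : Fin (r + 1) → ℕ) (i : Fin (r + 1)) (hi : a i = 0) :
    Nat.multinomial Finset.univ (a ∘ i.succAbove) = Nat.multinomial Finset.univ a := by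
  simp [Nat.multinomial, Fin.sum_univ_succAbove a i,
    Fin.prod_univ_succAbove (fun j => (a j).factorial) i, hi]

lemma choose_eq_topFactor_mul {x y : ℕ} (hx : 2 ≤ x) (hy : 2 ≤ y) :
    (Nat.choose (x + y - 2) (x - 1) : ℝ) =
      topFactor x y * Nat.choose (x - 2 + (y - 2)) (x - 2) := by
  obtain ⟨a, rfl⟩ := Nat.exists_eq_add_of_le' hx
  obtain ⟨b, rfl⟩ := Nat.exists_eq_add_of_le' hy
  have e1 : a + 2 + (b + 2) - 2 = (a + 1) + (b + 1) := by omega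
  have e2 : a + 2 - 1 = a + 1 := by omega
  simp only [e1, e2, Nat.add_sub_cancel]
  rw [Nat.cast_add_choose, Nat.cast_add_choose, show a + 1 + (b + 1) = a + b + 1 + 1 by ring,
    Nat.factorial_succ, Nat.factorial_succ, Nat.factorial_succ, Nat.factorial_succ, topFactor]
  have ha : (a.factorial : ℝ) ≠ 0 := by positivity
  have hb : (b.factorial : ℝ) ≠ 0 := by positivity
  have ha' : (a : ℝ) + 1 ≠ 0 := by positivity
  have hb' : (b : ℝ) + 1 ≠ 0 := by positivity
  have e3 : ((a + 2 : ℕ) : ℝ) - 1 = a + 1 := by push_cast; ring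
  have e4 : ((b + 2 : ℕ) : ℝ) - 1 = b + 1 := by push_cast; ring
  rw [e3, e4]
  push_cast
  field_simp
  ring

/-- The coordinates `p ≠ q` are two largest ones of `k`. -/
def IsTopPair {r : ℕ} (k : Fin r → ℕ) (p q : Fin r) : Prop :=
  p ≠ q ∧ ∀ j, j ≠ p → j ≠ q → k j ≤ k p ∧ k j ≤ k q

lemma IsTopPair.symm {r : ℕ} {k : Fin r → ℕ} {p q : Fin r} (h : IsTopPair k p q) :
    IsTopPair k q p :=
  ⟨h.1.symm, fun j hq hp => (h.2 j hp hq).symm⟩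

lemma IsTopPair.update_of_ne {r : ℕ} {k : Fin r → ℕ} {p q i : Fin r} (h : IsTopPair k p q)
    (hp : i ≠ p) (hq : i ≠ q) : IsTopPair (Function.update k i (k i - 1)) p q := by
  refine ⟨h.1, fun j hjp hjq => ?_⟩
  rw [Function.update_of_ne hp.symm, Function.update_of_ne hq.symm]
  have := h.2 j hjp hjq
  rcases eq_or_ne j i with rfl | hji
  · rw [Function.update_self]; omega
  · rwa [Function.update_of_ne hji]

/-- Decreasing the coordinate `p` of a top pair `(p, q)` either keeps `(p, q)` a top pair, or makes
some pair with the same values as before a top pair, in which case `k p ≤ k q`. -/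
lemma exists_factor_update {r : ℕ} {k : Fin r → ℕ} {p q : Fin r} (h : IsTopPair k p q)
    (hkp : 1 ≤ k p) {m c : ℝ}
    (hm : ∀ u v, IsTopPair (Function.update k p (k p - 1)) u v →
      m ≤ topFactor (Function.update k p (k p - 1) u : ℕ)
        (Function.update k p (k p - 1) v : ℕ) * c) :
    ∃ D, m ≤ D * c ∧ (D = topFactor (k p - 1) (k q) ∨
      (D = topFactor (k p) (k q) ∧ k p ≤ k q)) := by
  by_cases htie : ∃ j, j ≠ p ∧ j ≠ q ∧ k j = k p
  · obtain ⟨j, hjp, hjq, hj⟩ := htie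
    have hle : k p ≤ k q := hj ▸ (h.2 j hjp hjq).2
    have := hm j q ⟨hjq, fun i hij hiq => by
      rw [Function.update_of_ne hjp, Function.update_of_ne h.1.symm]
      rcases eq_or_ne i p with rfl | hip
      · rw [Function.update_self]; omega
      · rw [Function.update_of_ne hip]
        have := h.2 i hip hiq
        omega⟩
    rw [Function.update_of_ne hjp, Function.update_of_ne h.1.symm, hj] at this
    exact ⟨_, this, Or.inr ⟨rfl, hle⟩⟩
  · push Not at htie
    have := hm p q ⟨h.1, fun i hip hiq => by
      rw [Function.update_self, Function.update_of_ne h.1.symm, Function.update_of_ne hip]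
      have := h.2 i hip hiq
      have := htie i hip hiq
      omega⟩
    rw [Function.update_self, Function.update_of_ne h.1.symm, Nat.cast_sub hkp,
      Nat.cast_one] at this
    exact ⟨_, this, Or.inl rfl⟩

lemma sum_mul_le_of_topPair {r : ℕ} {k : Fin r → ℕ} {p q : Fin r} (h : IsTopPair k p q)
    (hk : ∀ i, 3 ≤ k i) {m c : Fin r → ℝ} {N T : ℝ} (hN : N = ∑ i, ((k i : ℝ) - 2)) (hT : 0 ≤ T)
    (hc : ∀ i, N * c i = (k i - 2) * T)
    (hm : ∀ i u v, IsTopPair (Function.update k i (k i - 1)) u v →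
      m i ≤ topFactor (Function.update k i (k i - 1) u : ℕ)
        (Function.update k i (k i - 1) v : ℕ) * c i) :
    ∑ i, m i ≤ topFactor (k p) (k q) * T := by
  have hk' : ∀ i, (3 : ℝ) ≤ k i := fun i => by exact_mod_cast hk i
  have hNpos : 0 < N := hN ▸ Finset.sum_pos (fun i _ => by linarith [hk' i]) ⟨p, Finset.mem_univ p⟩
  obtain ⟨Dp, hDp, hDp'⟩ := exists_factor_update h (by linarith [hk p]) (hm p)
  obtain ⟨Dq, hDq, hDq'⟩ := exists_factor_update h.symm (by linarith [hk q]) (hm q)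
  set C := topFactor (k p) (k q) with hC
  rw [topFactor_comm _ (k p : ℝ), topFactor_comm _ (k p : ℝ)] at hDq'
  let D : Fin r → ℝ := fun i => if i = p then Dp else if i = q then Dq else C
  have hD : ∀ i, m i ≤ D i * c i := by
    intro i
    rcases eq_or_ne i p with rfl | hip
    · simpa [D] using hDp
    rcases eq_or_ne i q with rfl | hiq
    · simpa [D, hip] using hDq
    have := hm i p q (h.update_of_ne hip hiq)
    rw [Function.update_of_ne hip.symm, Function.update_of_ne hiq.symm] at this
    simpa [D, hip, hiq] using this
  have hpair : 0 ≤ (C - Dp) * (k p - 2) + (C - Dq) * (k q - 2) := by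
    have hp := hk' p
    have hq := hk' q
    rcases hDp' with rfl | ⟨rfl, hpq⟩ <;> rcases hDq' with rfl | ⟨rfl, hqp⟩
    · exact (topFactor_recurrence (by linarith) (by linarith)).ge
    · have hqp' : (k q : ℝ) ≤ k p := by exact_mod_cast hqp
      have := topFactor_sub_one_left_le (by linarith) (by linarith) hqp'
      rw [sub_self, zero_mul, add_zero]
      exact mul_nonneg (by linarith) (by linarith)
    · have hpq' : (k p : ℝ) ≤ k q := by exact_mod_cast hpq
      have := topFactor_sub_one_left_le (by linarith) (by linarith) hpq'
      rw [topFactor_comm _ (k p : ℝ), topFactor_comm _ (k p : ℝ)] at this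
      rw [sub_self, zero_mul, zero_add]
      exact mul_nonneg (by linarith) (by linarith)
    · simp [hC]
  have hsum : ∑ i, (C - D i) * ((k i : ℝ) - 2) =
      (C - Dp) * (k p - 2) + (C - Dq) * (k q - 2) := by
    rw [Fintype.sum_eq_add p q h.1 (fun i hi => by simp [D, hi.1, hi.2])]
    simp [D, h.1.symm]
  refine le_of_mul_le_mul_left ?_ hNpos
  calc N * ∑ i, m i ≤ N * ∑ i, D i * c i :=
        mul_le_mul_of_nonneg_left (Finset.sum_le_sum fun i _ => hD i) hNpos.le
    _ = ∑ i, D i * ((k i - 2) * T) := by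
        rw [Finset.mul_sum]
        exact Finset.sum_congr rfl fun i _ => by rw [← hc i]; ring
    _ = (C * N - ∑ i, (C - D i) * ((k i : ℝ) - 2)) * T := by
        rw [hN, Finset.mul_sum, ← Finset.sum_sub_distrib, Finset.sum_mul]
        exact Finset.sum_congr rfl fun i _ => by ring
    _ ≤ C * N * T := mul_le_mul_of_nonneg_right (by rw [hsum]; linarith) hT
    _ = N * (C * T) := by ring

lemma MwProps.le_topFactor_mul_multinomial {M w : ∀ r : ℕ, (Fin r → ℕ) → ℕ} (hMw : MwProps M w)
    {r : ℕ} (hr : 2 ≤ r) (k : Fin r → ℕ) (hk : ∀ i, 2 ≤ k i) (p q : Fin r)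
    (h : IsTopPair k p q) :
    (M r k : ℝ) ≤
      topFactor (k p) (k q) * Nat.multinomial Finset.univ (fun i => k i - 2) := by
  induction hn : ∑ i, k i using Nat.strong_induction_on generalizing r with
  | _ n ih =>
  subst hn
  rcases hr.eq_or_lt with rfl | hr3
  · have hbase : (M 2 k : ℝ) =
        topFactor (k 0) (k 1) * Nat.multinomial Finset.univ (fun i => k i - 2) := by
      rw [(hMw.1 k hk).1, choose_eq_topFactor_mul (hk 0) (hk 1),
        show (Finset.univ : Finset (Fin 2)) = {0, 1} from rfl,
        Nat.binomial_eq_choose (by decide)]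
    have hpq := h.1
    rw [hbase]
    fin_cases p <;> fin_cases q
    · exact absurd rfl hpq
    · exact le_rfl
    · exact (congrArg (· * _) (topFactor_comm _ _)).le
    · exact absurd rfl hpq
  obtain ⟨s, rfl⟩ : ∃ s, r = s + 1 := ⟨r - 1, by omega⟩
  by_cases htwo : ∃ j, k j = 2
  · obtain ⟨j, hjp, hjq, hj⟩ : ∃ j, j ≠ p ∧ j ≠ q ∧ k j = 2 := by
      obtain ⟨i, hi⟩ := htwo
      obtain ⟨j, hj⟩ : ∃ j, j ∉ ({p, q} : Finset (Fin (s + 1))) := by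
        by_contra! hall
        have := Finset.card_le_card (fun x _ => hall x : Finset.univ ⊆ ({p, q} : Finset _))
        have := Finset.card_le_two (a := p) (b := q)
        simp only [Finset.card_univ, Fintype.card_fin] at *
        omega
      simp only [Finset.mem_insert, Finset.mem_singleton, not_or] at hj
      by_cases hip : i = p
      · subst hip
        exact ⟨j, hj.1, hj.2, le_antisymm (hi ▸ (h.2 j hj.1 hj.2).1) (hk j)⟩
      by_cases hiq : i = q
      · subst hiq
        exact ⟨j, hj.1, hj.2, le_antisymm (hi ▸ (h.2 j hj.1 hj.2).2) (hk j)⟩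
      exact ⟨i, hip, hiq, hi⟩
    obtain ⟨p, rfl⟩ := Fin.exists_succAbove_eq hjp.symm
    obtain ⟨q, rfl⟩ := Fin.exists_succAbove_eq hjq.symm
    rw [(hMw.2.1 s (by omega) k hk j hj).1,
      ← multinomial_comp_succAbove (fun i => k i - 2) j (by simp [hj])]
    refine ih _ ?_ (by omega) (k ∘ j.succAbove) (fun i => hk _) p q
      ⟨fun e => h.1 (congrArg _ e), fun i hip hiq => ?_⟩ rfl
    · rw [Fin.sum_univ_succAbove k j, hj]
      simp
    · exact h.2 _ (fun e => hip (Fin.succAbove_right_injective e))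
        (fun e => hiq (Fin.succAbove_right_injective e))
  · have hk3 : ∀ i, 3 ≤ k i := fun i =>
      lt_of_le_of_ne (hk i) fun e => htwo ⟨i, e.symm⟩
    rw [(hMw.2.2 (s + 1) hr k hk3).1, Nat.cast_sum]
    refine sum_mul_le_of_topPair h hk3
      (c := fun i => (Nat.multinomial Finset.univ
        (fun j => Function.update k i (k i - 1) j - 2) : ℝ))
      (N := ((∑ i, (k i - 2) : ℕ) : ℝ)) ?_ (Nat.cast_nonneg _) (fun i => ?_)
      (fun i u v huv => ih _ ?_ hr _ (fun j => ?_) u v huv rfl)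
    · rw [Nat.cast_sum]
      exact Finset.sum_congr rfl fun i _ => by rw [Nat.cast_sub (hk i), Nat.cast_ofNat]
    · have hupd : (fun j => Function.update k i (k i - 1) j - 2) =
          Function.update (fun j => k j - 2) i (k i - 2 - 1) := by
        funext j
        rcases eq_or_ne j i with rfl | hji
        · simp only [Function.update_self]; omega
        · simp only [Function.update_of_ne hji]
      have := sum_mul_multinomial_update_pred (fun j => k j - 2) i
        (by have := hk3 i; omega)
      have hcast : ((k i : ℝ) - 2) = ((k i - 2 : ℕ) : ℝ) := by
        rw [Nat.cast_sub (hk i), Nat.cast_ofNat]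
      rw [hupd, hcast]
      exact_mod_cast this
    · refine Finset.sum_lt_sum (fun j _ => ?_) ⟨i, Finset.mem_univ i, ?_⟩
      · rcases eq_or_ne j i with rfl | hji
        · rw [Function.update_self]; omega
        · rw [Function.update_of_ne hji]
      · rw [Function.update_self]
        have := hk3 i
        omega
    · rcases eq_or_ne j i with rfl | hji
      · rw [Function.update_self]
        have := hk3 j
        omega
      · rw [Function.update_of_ne hji]
        exact hk j

theorem stmt_7 (M w : ∀ r : ℕ, (Fin r → ℕ) → ℕ) (hMw : MwProps M w)
    (r : ℕ) (hr : 2 ≤ r) (k : Fin r → ℕ) (hk : ∀ i, 2 ≤ k i)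
    (hmono : ∀ i j : Fin r, i ≤ j → k j ≤ k i) :
    (M r k : ℝ) ≤
      ((k ⟨0, by omega⟩ : ℝ) + (k ⟨1, by omega⟩ : ℝ) - 2) *
          ((k ⟨0, by omega⟩ : ℝ) + (k ⟨1, by omega⟩ : ℝ) - 3) /
          (((k ⟨0, by omega⟩ : ℝ) - 1) * ((k ⟨1, by omega⟩ : ℝ) - 1)) *
        (Nat.multinomial Finset.univ (fun i => k i - 2) : ℝ) := by
  refine hMw.le_topFactor_mul_multinomial hr k hk ⟨0, by omega⟩ ⟨1, by omega⟩
    ⟨by simp, fun j h0 h1 => ⟨hmono _ _ (Fin.mk_le_of_le_val (Nat.zero_le _)),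
      hmono _ _ (Fin.mk_le_of_le_val ?_)⟩⟩
  have : (j : ℕ) ≠ 0 := fun e => h0 (Fin.ext e)
  omega
end

section
/- For integers r ≥ 2 and k_1, …, k_r ≥ 3, M_r(k_1,…,k_r) = Σ_{i=1}^r Σ_{j=1, j≠i}^r Σ_{m=3}^{k_j} m · multinomial(k_1+⋯+k_r−2r−m+1; a_1,…,a_r), where a_i = k_i−3, a_j = k_j−m, and a_l = k_l−2 for all l ∉ {i,j}. -/
/-- Pascal's recurrence for multinomial coefficients. -/
lemma multinomial_eq_sum_update {ι : Type*} [Fintype ι] [DecidableEq ι] (a : ι → ℕ) (ha : a ≠ 0) :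
    Nat.multinomial Finset.univ a =
      ∑ l, if a l = 0 then 0 else Nat.multinomial Finset.univ (Function.update a l (a l - 1)) := by
  have hpos : 0 < ∏ i, (a i).factorial := Finset.prod_pos fun i _ => Nat.factorial_pos _
  apply Nat.eq_of_mul_eq_mul_left hpos
  rw [Nat.multinomial_spec, Finset.mul_sum]
  have hterm : ∀ l, ((∏ i, (a i).factorial) * if a l = 0 then 0 else
      Nat.multinomial Finset.univ (Function.update a l (a l - 1))) =
      a l * (∑ i, a i - 1).factorial := by
    intro l
    split_ifs with h
    · simp [h]
    · obtain ⟨c, hc⟩ := Nat.exists_eq_succ_of_ne_zero h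
      have hspec := Nat.multinomial_spec Finset.univ (Function.update a l (a l - 1))
      have hprod : ∏ i, (a i).factorial =
          a l * ∏ i, (Function.update a l (a l - 1) i).factorial := by
        rw [← Finset.mul_prod_erase _ _ (Finset.mem_univ l),
          ← Finset.mul_prod_erase _ (fun i => (Function.update a l (a l - 1) i).factorial)
            (Finset.mem_univ l), ← mul_assoc]
        congr 1
        · simp [hc, Nat.factorial_succ]
        · refine Finset.prod_congr rfl fun i hi => ?_
          rw [Function.update_of_ne (Finset.ne_of_mem_erase hi)]
      have hsum : ∑ i, Function.update a l (a l - 1) i = ∑ i, a i - 1 := by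
        rw [Finset.sum_update_of_mem (Finset.mem_univ l), ← Finset.erase_eq,
          ← Finset.add_sum_erase _ a (Finset.mem_univ l)]
        omega
      rw [hprod, mul_assoc, hspec, hsum]
  rw [Finset.sum_congr rfl fun l _ => hterm l, ← Finset.sum_mul]
  have hne : ∑ i, a i ≠ 0 := by
    intro h
    apply ha
    funext i
    simpa using (Finset.sum_eq_zero_iff.mp h) i (Finset.mem_univ i)
  exact (Nat.mul_factorial_pred hne).symm

/-- The number of monotone lattice paths from `x` down to `s`. -/
def latticePaths {ι : Type*} [Fintype ι] [DecidableEq ι] (s x : ι → ℕ) : ℕ :=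
  if ∀ i, s i ≤ x i then Nat.multinomial Finset.univ (x - s) else 0

lemma latticePaths_of_le {ι : Type*} [Fintype ι] [DecidableEq ι] {s x : ι → ℕ} (h : s ≤ x) :
    latticePaths s x = Nat.multinomial Finset.univ (x - s) :=
  if_pos h

lemma latticePaths_of_not_le {ι : Type*} [Fintype ι] [DecidableEq ι] {s x : ι → ℕ}
    (h : ¬ s ≤ x) : latticePaths s x = 0 :=
  if_neg h

lemma latticePaths_eq_sum_update {ι : Type*} [Fintype ι] [DecidableEq ι] (s x : ι → ℕ) :
    latticePaths s x =
      (∑ l, if x l = 0 then 0 else latticePaths s (Function.update x l (x l - 1))) +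
        if x = s then 1 else 0 := by
  have hle : ∀ l, Function.update x l (x l - 1) ≤ x := fun l =>
    update_le_iff.mpr ⟨Nat.sub_le _ _, fun _ _ => le_rfl⟩
  by_cases hs : s ≤ x
  · have hterm : ∀ l, (if x l = 0 then 0 else latticePaths s (Function.update x l (x l - 1))) =
        if (x - s) l = 0 then 0 else
          Nat.multinomial Finset.univ (Function.update (x - s) l ((x - s) l - 1)) := by
      intro l
      have hl := hs l
      by_cases h : (x - s) l = 0
      · rw [if_pos h]
        split_ifs with h0
        · rfl
        · refine latticePaths_of_not_le fun hcon => ?_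
          have := hcon l
          simp only [Function.update_self, Pi.sub_apply] at this h
          omega
      · rw [if_neg h]
        simp only [Pi.sub_apply] at h
        rw [if_neg (by omega), latticePaths, if_pos]
        · congr 1
          funext i
          by_cases hi : i = l
          · subst hi
            simp only [Pi.sub_apply, Function.update_self]
            omega
          · simp [Function.update_of_ne hi]
        · exact le_update_iff.mpr ⟨by omega, fun i _ => hs i⟩
    rw [Finset.sum_congr rfl fun l _ => hterm l, latticePaths_of_le hs]
    by_cases hx : x = s
    · subst hx
      simp [Nat.multinomial]
    · rw [if_neg hx, add_zero]
      refine multinomial_eq_sum_update _ fun h0 => hx (le_antisymm (fun i => ?_) hs)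
      exact Nat.sub_eq_zero_iff_le.mp (congrFun h0 i)
  · rw [latticePaths_of_not_le hs, if_neg (fun h => hs h.ge), add_zero]
    symm
    refine Finset.sum_eq_zero fun l _ => ?_
    split_ifs
    · rfl
    · exact latticePaths_of_not_le fun h => hs (h.trans (hle l))

/-- The lattice point with coordinate `1` at `i` and `m` at `j`. -/
def cornerPoint {ι : Type*} [DecidableEq ι] (i j : ι) (m : ℕ) : ι → ℕ :=
  fun l => if l = i then 1 else if l = j then m else 0

/-- Lattice paths from `x` to a point `cornerPoint i j m`, weighted by `m + 2`. -/
def weightedPaths {ι : Type*} [Fintype ι] [DecidableEq ι] (B : ℕ) (x : ι → ℕ) : ℕ :=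
  ∑ i, ∑ j, if j = i then 0 else
    ∑ m ∈ Finset.Icc 1 B, (m + 2) * latticePaths (cornerPoint i j m) x

lemma weightedPaths_eq_sum_update {ι : Type*} [Fintype ι] [DecidableEq ι] (B : ℕ) (x : ι → ℕ) :
    weightedPaths B x =
      (∑ l, if x l = 0 then 0 else weightedPaths B (Function.update x l (x l - 1))) +
        ∑ i, ∑ j, if j = i then 0 else
          ∑ m ∈ Finset.Icc 1 B, (m + 2) * if x = cornerPoint i j m then 1 else 0 := by
  have hswap : (∑ l, if x l = 0 then 0 else weightedPaths B (Function.update x l (x l - 1))) =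
      ∑ i, ∑ j, if j = i then 0 else ∑ m ∈ Finset.Icc 1 B, (m + 2) *
        ∑ l, if x l = 0 then 0 else
          latticePaths (cornerPoint i j m) (Function.update x l (x l - 1)) := by
    have hterm : ∀ l, (if x l = 0 then 0 else
        weightedPaths B (Function.update x l (x l - 1))) =
        ∑ i, ∑ j, if j = i then 0 else ∑ m ∈ Finset.Icc 1 B, (m + 2) *
          if x l = 0 then 0 else
            latticePaths (cornerPoint i j m) (Function.update x l (x l - 1)) := by
      intro l
      by_cases h : x l = 0 <;> simp [h, weightedPaths]
    rw [Finset.sum_congr rfl fun l _ => hterm l, Finset.sum_comm]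
    refine Finset.sum_congr rfl fun i _ => ?_
    rw [Finset.sum_comm]
    refine Finset.sum_congr rfl fun j _ => ?_
    split_ifs
    · simp
    · rw [Finset.sum_comm]
      simp_rw [Finset.mul_sum]
  rw [hswap, ← Finset.sum_add_distrib]
  refine Finset.sum_congr rfl fun i _ => ?_
  rw [← Finset.sum_add_distrib]
  refine Finset.sum_congr rfl fun j _ => ?_
  split_ifs
  · rfl
  · rw [← Finset.sum_add_distrib]
    refine Finset.sum_congr rfl fun m _ => ?_
    rw [← mul_add, ← latticePaths_eq_sum_update]

lemma latticePaths_eq_zero_of_lt {ι : Type*} [Fintype ι] [DecidableEq ι] {s x : ι → ℕ} {l : ι}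
    (h : x l < s l) : latticePaths s x = 0 :=
  latticePaths_of_not_le fun hs => (hs l).not_gt h

lemma latticePaths_succAbove {r : ℕ} (s x : Fin (r + 1) → ℕ) (p : Fin (r + 1))
    (hs : s p = 0) (hx : x p = 0) :
    latticePaths s x = latticePaths (s ∘ p.succAbove) (x ∘ p.succAbove) := by
  have hiff : (∀ i, s i ≤ x i) ↔ ∀ i, (s ∘ p.succAbove) i ≤ (x ∘ p.succAbove) i := by
    simp [Fin.forall_iff_succAbove p, hs]
  simp only [latticePaths, hiff, Nat.multinomial, Fin.sum_univ_succAbove _ p,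
    Fin.prod_univ_succAbove _ p]
  simp [hs, hx]

lemma weightedPaths_succAbove {r : ℕ} (B : ℕ) (x : Fin (r + 1) → ℕ) (p : Fin (r + 1))
    (hx : x p = 0) : weightedPaths B x = weightedPaths B (x ∘ p.succAbove) := by
  have hi : ∀ j m, latticePaths (cornerPoint p j m) x = 0 := fun j m =>
    latticePaths_eq_zero_of_lt (l := p) (by simp [cornerPoint, hx])
  have hj : ∀ i, i ≠ p → ∀ m ∈ Finset.Icc 1 B, latticePaths (cornerPoint i p m) x = 0 :=
    fun i hip m hm => latticePaths_eq_zero_of_lt (l := p) (by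
      have := (Finset.mem_Icc.mp hm).1
      simp [cornerPoint, hx, hip.symm]
      omega)
  simp only [weightedPaths]
  rw [Fin.sum_univ_succAbove _ p]
  simp only [hi, mul_zero, Finset.sum_const_zero, ite_self, zero_add]
  refine Finset.sum_congr rfl fun i _ => ?_
  rw [Fin.sum_univ_succAbove _ p, if_neg (Fin.succAbove_ne p i).symm,
    Finset.sum_eq_zero fun m hm => by rw [hj _ (Fin.succAbove_ne p i) m hm, mul_zero], zero_add]
  refine Finset.sum_congr rfl fun j _ => ?_
  simp only [Fin.succAbove_right_inj]
  refine if_congr Iff.rfl rfl (Finset.sum_congr rfl fun m _ => ?_)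
  rw [latticePaths_succAbove _ _ p
    (by simp [cornerPoint, (Fin.succAbove_ne p _).symm]) hx]
  congr 2
  funext l
  simp [cornerPoint]

lemma weightedPaths_fin_two_eq_zero (B : ℕ) (x : Fin 2 → ℕ) (l : Fin 2) (hx : x l = 0) :
    weightedPaths B x = 0 := by
  rw [weightedPaths_succAbove B x l hx]
  simp [weightedPaths]

lemma sum_cornerPoint_fin_two (B : ℕ) (x : Fin 2 → ℕ) (i j : Fin 2) (hij : j ≠ i)
    (hj : 0 < x j) (hB : x j ≤ B) :
    (∑ m ∈ Finset.Icc 1 B, (m + 2) * if x = cornerPoint i j m then 1 else 0) =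
      if x i = 1 then x j + 2 else 0 := by
  have hiff : ∀ m, x = cornerPoint i j m ↔ x i = 1 ∧ x j = m := by
    intro m
    constructor
    · intro h
      rw [h]
      simp [cornerPoint, hij]
    · rintro ⟨h1, h2⟩
      funext l
      have : l = i ∨ l = j := by omega
      rcases this with rfl | rfl
      · simp [cornerPoint, h1]
      · simp [cornerPoint, hij, h2]
  simp only [hiff]
  by_cases h : x i = 1
  · simp [h]
    omega
  · simp [h]

lemma cornerPoint_ne_of_pos {r : ℕ} (hr : 3 ≤ r) (x : Fin r → ℕ) (hx : ∀ i, 0 < x i)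
    (i j : Fin r) (m : ℕ) : x ≠ cornerPoint i j m := by
  obtain ⟨l, hl⟩ : ∃ l, l ∉ ({i, j} : Finset (Fin r)) := by
    by_contra! h
    have hc := Finset.card_le_card (fun l _ => h l : (Finset.univ : Finset (Fin r)) ⊆ {i, j})
    have := Finset.card_le_two (a := i) (b := j)
    simp at hc
    omega
  simp only [Finset.mem_insert, Finset.mem_singleton, not_or] at hl
  intro h
  have := hx l
  rw [h] at this
  simp [cornerPoint, hl] at this

lemma MwProps.eq_weightedPaths {M w : ∀ r : ℕ, (Fin r → ℕ) → ℕ} (hMw : MwProps M w) (B n : ℕ) :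
    ∀ r : ℕ, 2 ≤ r → ∀ x : Fin r → ℕ, (∀ i, x i ≤ B) → ∑ i, x i + r = n →
      (∃ i j, i ≠ j ∧ 0 < x i ∧ 0 < x j) → M r (fun i => x i + 2) = weightedPaths B x := by
  obtain ⟨h2, hdel, hrec⟩ := hMw
  induction n using Nat.strong_induction_on with
  | _ n ih =>
  intro r hr x hB hn hne
  by_cases h0 : ∃ p, x p = 0
  · obtain ⟨p, hp⟩ := h0
    obtain ⟨i, j, hij, hi, hj⟩ := hne
    obtain ⟨s, rfl⟩ : ∃ s, r = s + 1 := ⟨r - 1, by omega⟩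
    obtain ⟨i', rfl⟩ := Fin.exists_succAbove_eq (x := i) (y := p) (by rintro rfl; omega)
    obtain ⟨j', rfl⟩ := Fin.exists_succAbove_eq (x := j) (y := p) (by rintro rfl; omega)
    have hij' : i' ≠ j' := fun h => hij (by rw [h])
    have hs : 2 ≤ s := by
      by_contra! h
      exact hij' (Fin.ext (by omega))
    rw [(hdel s hs _ (fun i => by omega) p (by simp [hp])).1, weightedPaths_succAbove B x p hp]
    refine ih (n - 1) (by omega) s hs (x ∘ p.succAbove) (fun i => hB _) ?_ ⟨i', j', hij', hi, hj⟩
    rw [Fin.sum_univ_succAbove _ p, hp] at hn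
    simp only [Function.comp]
    omega
  push Not at h0
  have hpos : ∀ i, 0 < x i := fun i => Nat.pos_of_ne_zero (h0 i)
  have hupd : ∀ l, Function.update (fun i => x i + 2) l (x l + 2 - 1) =
      fun i => Function.update x l (x l - 1) i + 2 := by
    intro l
    have := hpos l
    funext i
    by_cases hi : i = l
    · subst hi
      simp only [Function.update_self]
      omega
    · simp [Function.update_of_ne hi]
  have hstep : ∀ l, (∃ i j, i ≠ j ∧ 0 < Function.update x l (x l - 1) i ∧
      0 < Function.update x l (x l - 1) j) →
      M r (fun i => Function.update x l (x l - 1) i + 2) =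
        weightedPaths B (Function.update x l (x l - 1)) := by
    intro l hl
    refine ih (n - 1) (by omega) r hr _ (fun i => ?_) ?_ hl
    · have hle : Function.update x l (x l - 1) ≤ x :=
        update_le_iff.mpr ⟨Nat.sub_le _ _, fun _ _ => le_rfl⟩
      exact (hle i).trans (hB i)
    · have := hpos l
      rw [Finset.sum_update_of_mem (Finset.mem_univ l), ← Finset.erase_eq]
      rw [← Finset.add_sum_erase _ x (Finset.mem_univ l)] at hn
      omega
  rw [(hrec r hr _ (fun i => by have := hpos i; omega)).1, weightedPaths_eq_sum_update]
  simp only [hupd, h0, if_false]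
  rcases hr.eq_or_lt with rfl | hr3
  · have hval : ∀ l l' : Fin 2, l' ≠ l → M 2 (fun i => Function.update x l (x l - 1) i + 2) =
        weightedPaths B (Function.update x l (x l - 1)) + if x l = 1 then x l' + 2 else 0 := by
      intro l l' hll
      by_cases h1 : x l = 1
      · rw [weightedPaths_fin_two_eq_zero B _ l (by simp [h1]), if_pos h1,
          (h2 _ (fun i => by omega)).1]
        fin_cases l <;> fin_cases l' <;> simp_all
      · rw [if_neg h1, add_zero]
        have := hpos l
        exact hstep l ⟨l, l', hll.symm, by simp; omega, by
          simp [Function.update_of_ne hll, hpos]⟩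
    simp only [Fin.sum_univ_two, hval 0 1 (by decide), hval 1 0 (by decide), if_true,
      one_ne_zero, zero_ne_one, if_false,
      sum_cornerPoint_fin_two B x 0 1 (by decide) (hpos _) (hB _),
      sum_cornerPoint_fin_two B x 1 0 (by decide) (hpos _) (hB _)]
    ring
  · simp only [cornerPoint_ne_of_pos hr3 x hpos, if_false, mul_zero, Finset.sum_const_zero,
      ite_self, add_zero]
    refine Finset.sum_congr rfl fun l _ => hstep l ?_
    obtain ⟨i, hi, j, hj, hij⟩ := Finset.one_lt_card.mp
      (show 1 < (Finset.univ.erase l).card by simp; omega)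
    refine ⟨i, j, hij, ?_, ?_⟩
    · rw [Function.update_of_ne (Finset.ne_of_mem_erase hi)]
      exact hpos i
    · rw [Function.update_of_ne (Finset.ne_of_mem_erase hj)]
      exact hpos j

theorem stmt_9 (M w : ∀ r : ℕ, (Fin r → ℕ) → ℕ) (hMw : MwProps M w)
    (r : ℕ) (hr : 2 ≤ r) (k : Fin r → ℕ) (hk : ∀ i, 3 ≤ k i) :
    M r k = ∑ i : Fin r, ∑ j ∈ Finset.univ.erase i, ∑ m ∈ Finset.Icc 3 (k j),
      m * Nat.multinomial Finset.univ
        (fun l => if l = i then k i - 3 else if l = j then k j - m else k l - 2) := by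
  have hx : k = fun i => (k i - 2) + 2 := by
    funext i
    have := hk i
    omega
  have hmain := hMw.eq_weightedPaths (∑ i, k i) _ r hr (fun i => k i - 2)
    (fun i => (Nat.sub_le _ _).trans (Finset.single_le_sum_of_canonicallyOrdered
      (Finset.mem_univ i))) rfl
    ⟨⟨0, by omega⟩, ⟨1, by omega⟩, by simp, by have := hk ⟨0, by omega⟩; omega,
      by have := hk ⟨1, by omega⟩; omega⟩
  rw [← hx] at hmain
  rw [hmain, weightedPaths]
  refine Finset.sum_congr rfl fun i _ => ?_
  rw [← Finset.add_sum_erase _ _ (Finset.mem_univ i), if_pos rfl, zero_add]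
  refine Finset.sum_congr rfl fun j hj => ?_
  have hji := Finset.ne_of_mem_erase hj
  have hle : k j ≤ ∑ i, k i :=
    Finset.single_le_sum_of_canonicallyOrdered (Finset.mem_univ j)
  have hi := hk i
  have hj' := hk j
  rw [if_neg hji]
  have hsub : Finset.Icc 1 (k j - 2) ⊆ Finset.Icc 1 (∑ i, k i) :=
    Finset.Icc_subset_Icc_right (by omega)
  rw [← Finset.sum_subset hsub]
  · have himage : Finset.Icc 3 (k j) = (Finset.Icc 1 (k j - 2)).map (addRightEmbedding 2) := by
      rw [Finset.map_add_right_Icc, Nat.sub_add_cancel (by omega)]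
    rw [himage, Finset.sum_map]
    refine Finset.sum_congr rfl fun m hm => ?_
    have hm' := Finset.mem_Icc.mp hm
    rw [latticePaths, if_pos]
    · simp only [addRightEmbedding_apply]
      congr 2
      funext l
      simp only [Pi.sub_apply, cornerPoint]
      split_ifs with h1 h2
      · subst h1; omega
      · subst h2; omega
      · omega
    · intro l
      simp only [cornerPoint]
      split_ifs with h1 h2
      · subst h1; omega
      · subst h2; omega
      · omega
  · intro m hm hm'
    rw [latticePaths_eq_zero_of_lt (l := j), mul_zero]
    simp only [Finset.mem_Icc] at hm hm'
    simp only [cornerPoint, if_neg hji, if_true]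
    omega
end

section
/- For integers r ≥ 2 and k ≥ 4, the diagonal waste function satisfies w_r(k) ≥ (r−2) · r! · ((e_r − 1) · Σ_{i=0}^{k−4} (r!)^i − (r!)^{k−4}) + Σ_{j=0}^{r−3} binom(r,j) · multinomial(r(k−3)+j−1; k−2,…,k−2, k−3,…,k−3, k−4) · (r−j) · (r−j−2 + w_{r−j}(3)), where in the multinomial coefficient the entry k−2 is repeated j times and the entry k−3 is repeated r−j−1 times, and e_r = Σ_{n=0}^r 1/n!. -/
open Finset in
/-- Pascal's rule for multinomial coefficients. -/
theorem multinomial_eq_sum_sub_single {ι : Type*} [Fintype ι] [DecidableEq ι] (d : ι → ℕ)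
    (hd : d ≠ 0) :
    Nat.multinomial univ d =
      ∑ i with 0 < d i, Nat.multinomial univ (d - Pi.single i 1) := by
  have hprod : 0 < ∏ i, (d i).factorial := prod_pos fun i _ => Nat.factorial_pos _
  apply Nat.eq_of_mul_eq_mul_left hprod
  rw [Nat.multinomial_spec, mul_sum]
  have key : ∀ i ∈ univ.filter (fun i => 0 < d i),
      (∏ i, (d i).factorial) * Nat.multinomial univ (d - Pi.single i 1) =
        d i * (∑ i, d i - 1).factorial := by
    intro i hi
    have hi : 0 < d i := by simpa using hi
    have hs : ∑ l, (d - Pi.single i 1 : ι → ℕ) l = ∑ l, d l - 1 := by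
      rw [← add_sum_erase _ _ (mem_univ i), ← add_sum_erase univ d (mem_univ i)]
      have : ∑ l ∈ univ.erase i, (d - Pi.single i 1 : ι → ℕ) l = ∑ l ∈ univ.erase i, d l :=
        sum_congr rfl fun l hl => by simp [ne_of_mem_erase hl]
      rw [this]
      simp only [Pi.sub_apply, Pi.single_eq_same]
      lia
    have hp : ∏ l, (d l).factorial = d i * ∏ l, ((d - Pi.single i 1 : ι → ℕ) l).factorial := by
      have h1 := mul_prod_erase univ (fun l => ((d - Pi.single i 1 : ι → ℕ) l).factorial)
        (mem_univ i)
      have h2 : ∏ l ∈ univ.erase i, ((d - Pi.single i 1 : ι → ℕ) l).factorial =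
          ∏ l ∈ univ.erase i, (d l).factorial :=
        prod_congr rfl fun l hl => by simp [ne_of_mem_erase hl]
      rw [← mul_prod_erase _ _ (mem_univ i), ← h1, h2, ← mul_assoc]
      simp [Nat.mul_factorial_pred hi.ne']
    rw [hp, mul_assoc, Nat.multinomial_spec, hs]
  rw [sum_congr rfl key, ← sum_mul]
  have hsum : ∑ i with 0 < d i, d i = ∑ i, d i := by
    rw [sum_filter]
    exact sum_congr rfl fun i _ => by split_ifs <;> lia
  rw [hsum, Nat.mul_factorial_pred]
  intro h
  apply hd
  ext i
  simpa using (sum_eq_zero_iff.mp h) i (mem_univ i)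

open Finset in
/-- A function on the lattice that dominates the sum of its values at the lower neighbours plus a
source term dominates the source summed over all points below, weighted by the number of descending
lattice paths. -/
theorem sum_mul_multinomial_le {ι : Type*} [Fintype ι] [DecidableEq ι] (g d : (ι → ℕ) → ℕ)
    (h : ∀ q, d q + ∑ i with 0 < q i, g (q - Pi.single i 1) ≤ g q) (q : ι → ℕ) :
    ∑ p ∈ Iic q, d p * Nat.multinomial univ (q - p) ≤ g q := by
  induction hn : ∑ i, q i using Nat.strong_induction_on generalizing q with
  | _ n ih =>
  subst hn
  refine le_trans ?_ (h q)
  rw [← add_sum_erase _ _ (mem_Iic.mpr le_rfl)]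
  have h0 : Nat.multinomial univ (q - q) = 1 := by simp [Nat.multinomial]
  rw [h0, mul_one]
  gcongr
  have h1 : ∀ p ∈ (Iic q).erase q, d p * Nat.multinomial univ (q - p) =
      ∑ i with p i < q i, d p * Nat.multinomial univ (q - Pi.single i 1 - p) := by
    intro p hp
    rw [mem_erase, mem_Iic] at hp
    rw [multinomial_eq_sum_sub_single, mul_sum]
    · refine sum_congr ?_ fun i _ => by rw [tsub_right_comm]
      ext i
      simp
    · intro h0
      exact hp.1 (le_antisymm hp.2 (tsub_eq_zero_iff_le.mp h0))
  rw [sum_congr rfl h1]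
  rw [sum_comm' (s' := fun i => Iic (q - Pi.single i 1)) (t' := univ.filter fun i => 0 < q i)]
  · refine sum_le_sum fun i hi => ih _ ?_ _ rfl
    have hi : 0 < q i := by simpa using hi
    refine sum_lt_sum (fun l _ => by simp) ⟨i, mem_univ i, ?_⟩
    simp [hi]
  · intro p i
    simp only [mem_erase, mem_Iic, mem_filter, mem_univ, true_and, Pi.le_def]
    constructor
    · rintro ⟨⟨-, hle⟩, hlt⟩
      refine ⟨fun l => ?_, by lia⟩
      by_cases hl : l = i
      · subst hl
        simp only [Pi.sub_apply, Pi.single_eq_same]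
        lia
      · simpa [hl] using hle l
    · rintro ⟨hle, hpos⟩
      have hi := hle i
      simp only [Pi.sub_apply, Pi.single_eq_same] at hi
      refine ⟨⟨?_, fun l => (hle l).trans (by simp)⟩, by lia⟩
      rintro rfl
      lia

open Finset in
/-- Concatenating lattice paths shows that multinomial coefficients are supermultiplicative. -/
theorem multinomial_mul_multinomial_le {ι : Type*} [Fintype ι] [DecidableEq ι] (a b : ι → ℕ) :
    Nat.multinomial univ a * Nat.multinomial univ b ≤ Nat.multinomial univ (a + b) := by
  have key := sum_mul_multinomial_le (fun q => Nat.multinomial univ (a + q))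
    (fun q => if q = 0 then Nat.multinomial univ a else 0) (fun q => ?_) b
  · refine le_trans ?_ key
    refine le_trans ?_ (single_le_sum (fun _ _ => Nat.zero_le _) (mem_Iic.mpr (zero_le : 0 ≤ b)))
    simp
  · by_cases hq : q = 0
    · simp [hq]
    · simp only [hq, if_false, zero_add]
      rw [multinomial_eq_sum_sub_single (a + q)]
      · have : ∀ i ∈ univ.filter (fun i => 0 < q i),
            Nat.multinomial univ (a + (q - Pi.single i 1)) =
              Nat.multinomial univ (a + q - Pi.single i 1) := by
          intro i hi
          rw [add_tsub_assoc_of_le]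
          intro l
          by_cases hl : l = i
          · subst hl
            simpa [Nat.one_le_iff_ne_zero, Nat.pos_iff_ne_zero] using hi
          · simp [hl]
        rw [sum_congr rfl this]
        refine sum_le_sum_of_subset fun i => ?_
        simp only [mem_filter, mem_univ, true_and, Pi.add_apply]
        lia
      · intro h
        apply hq
        ext i
        have := congrFun h i
        simp only [Pi.add_apply, Pi.zero_apply] at this ⊢
        lia

open Finset in
theorem factorial_pow_mul_factorial_le_multinomial {ι : Type*} [Fintype ι] [DecidableEq ι] (i : ℕ)
    (s : Finset ι) :
    (Fintype.card ι).factorial ^ i * (Fintype.card ι - #s).factorial ≤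
      Nat.multinomial univ (fun l => if l ∈ s then i else i + 1) := by
  have h1 : ∀ t : Finset ι, Nat.multinomial univ (fun l => if l ∈ t then 0 else 1) =
      (Fintype.card ι - #t).factorial := by
    intro t
    have hp : ∏ l, (if l ∈ t then 0 else 1).factorial = 1 :=
      prod_eq_one fun l _ => by split_ifs <;> rfl
    have hs : ∑ l, (if l ∈ t then 0 else 1) = Fintype.card ι - #t := by
      have h2 : ∀ l, (if l ∈ t then 0 else 1) = if l ∈ tᶜ then 1 else 0 := by
        intro l
        by_cases hl : l ∈ t <;> simp [hl]
      rw [sum_congr rfl fun l _ => h2 l, sum_ite_mem, univ_inter, sum_const, card_compl]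
      simp
    rw [Nat.multinomial, hp, hs, Nat.div_one]
  induction i with
  | zero => simp [h1]
  | succ n ih =>
    have h2 := multinomial_mul_multinomial_le (fun l => if l ∈ (∅ : Finset ι) then 0 else 1)
      (fun l => if l ∈ s then n else n + 1)
    rw [h1, card_empty, Nat.sub_zero] at h2
    calc _ = (Fintype.card ι).factorial *
          ((Fintype.card ι).factorial ^ n * (Fintype.card ι - #s).factorial) := by ring
      _ ≤ _ := Nat.mul_le_mul_left _ ih
      _ ≤ _ := h2
      _ = _ := by
        congr 1
        ext l
        by_cases hl : l ∈ s <;> simp [hl, add_comm]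

open Finset in
theorem multinomial_ite_congr {ι : Type*} [Fintype ι] [DecidableEq ι] {J J' : Finset ι} {l l' : ι}
    (hl : l ∉ J) (hl' : l' ∉ J') (hJ : #J = #J') (a b c : ℕ) :
    Nat.multinomial univ (fun i => if i ∈ J then a else if i = l then c else b) =
      Nat.multinomial univ (fun i => if i ∈ J' then a else if i = l' then c else b) := by
  have hcard : ∀ (J : Finset ι) (l : ι), l ∉ J →
      #((univ.filter fun i => i ∉ J).erase l) = Fintype.card ι - #J - 1 := by
    intro J l hl
    rw [card_erase_of_mem (by simpa using hl), ← card_compl]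
    congr 2
    ext
    simp
  have hsum : ∀ (J : Finset ι) (l : ι), l ∉ J →
      ∑ i, (if i ∈ J then a else if i = l then c else b) =
        #J * a + (c + (Fintype.card ι - #J - 1) * b) := by
    intro J l hlJ
    have hl : l ∈ univ.filter (fun i => i ∉ J) := by simpa using hlJ
    rw [sum_ite, ← add_sum_erase _ _ hl]
    rw [sum_congr rfl (g := fun _ => b) (fun i hi => if_neg (ne_of_mem_erase hi))]
    simp [hcard J l hlJ]
  have hprod : ∀ (J : Finset ι) (l : ι), l ∉ J →
      ∏ i, (if i ∈ J then a else if i = l then c else b).factorial =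
        a.factorial ^ #J * (c.factorial * b.factorial ^ (Fintype.card ι - #J - 1)) := by
    intro J l hlJ
    have hl : l ∈ univ.filter (fun i => i ∉ J) := by simpa using hlJ
    simp_rw [apply_ite Nat.factorial]
    rw [prod_ite, ← mul_prod_erase _ _ hl]
    rw [prod_congr rfl (g := fun _ => b.factorial) (fun i hi => if_neg (ne_of_mem_erase hi))]
    simp [hcard J l hlJ]
  simp only [Nat.multinomial, hsum J l hl, hsum J' l' hl', hprod J l hl, hprod J' l' hl', hJ]

open Finset in
/-- The recurrence for `w`, stated uniformly for tuples which may have coordinates equal to `2`. -/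
theorem MwProps.w_eq_sum {M w : ∀ r : ℕ, (Fin r → ℕ) → ℕ} (hMw : MwProps M w) {r : ℕ}
    (hr : 2 ≤ r) (k : Fin r → ℕ) (hk : ∀ i, 2 ≤ k i) :
    w r k = ∑ i with 2 < k i, w r (Function.update k i (k i - 1)) + (#{i | 2 < k i} - 2) := by
  induction r, hr using Nat.le_induction with
  | base =>
    have hw : ∀ k : Fin 2 → ℕ, (∀ i, 2 ≤ k i) → w 2 k = 0 := fun k hk => (hMw.1 k hk).2
    have hc : #{i | 2 < k i} ≤ 2 := by simpa using card_le_univ (univ.filter fun i => 2 < k i)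
    rw [hw k hk, sum_eq_zero, Nat.sub_eq_zero_of_le hc]
    intro i hi
    apply hw
    intro l
    have hi : 2 < k i := by simpa using hi
    by_cases hl : l = i
    · subst hl
      simp only [Function.update_self]
      lia
    · simpa [hl] using hk l
  | succ r hr ih =>
    by_cases h3 : ∀ i, 3 ≤ k i
    · have huniv : univ.filter (fun i => 2 < k i) = univ := by
        ext i
        simpa using Nat.lt_of_succ_le (h3 i)
      rw [huniv, (hMw.2.2 (r + 1) (by lia) k h3).2]
      simp
    · push Not at h3
      obtain ⟨i, hi⟩ := h3
      have hi2 : k i = 2 := by have := hk i; lia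
      rw [(hMw.2.1 r hr k hk i hi2).2, ih (k ∘ i.succAbove) (fun l => hk _)]
      rw [card_filter, card_filter, sum_filter, sum_filter, Fin.sum_univ_succAbove _ i,
        Fin.sum_univ_succAbove _ i]
      simp only [hi2, lt_irrefl, if_false, zero_add, Function.comp_apply]
      congr 1
      refine sum_congr rfl fun l _ => ?_
      split_ifs with hl
      · rw [(hMw.2.1 r hr (Function.update k (i.succAbove l) (k (i.succAbove l) - 1)) ?_ i ?_).2]
        · congr 1
          ext m
          by_cases hm : m = l
          · subst hm
            simp
          · simp [hm, Function.update_of_ne]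
        · intro m
          by_cases hm : m = i.succAbove l
          · subst hm
            simp only [Function.update_self]
            lia
          · simpa [hm] using hk m
        · rw [Function.update_of_ne (Fin.succAbove_ne i l).symm, hi2]
      · rfl

open Finset in
theorem MwProps.w_eq_w_three {M w : ∀ r : ℕ, (Fin r → ℕ) → ℕ} (hMw : MwProps M w) {r : ℕ}
    (hr : 2 ≤ r) (k : Fin r → ℕ) (hk : ∀ i, k i = 2 ∨ k i = 3) (h2 : 2 ≤ #{i | k i = 3}) :
    w r k = w #{i | k i = 3} (fun _ => 3) := by
  induction r, hr using Nat.le_induction with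
  | base =>
    have h : #{i | k i = 3} = 2 :=
      le_antisymm (by simpa using card_le_univ (univ.filter fun i => k i = 3)) h2
    rw [h, (hMw.1 _ fun i => by rcases hk i with h | h <;> lia).2, (hMw.1 _ fun i => by simp).2]
  | succ r hr ih =>
    by_cases h3 : ∀ i, k i = 3
    · have huniv : univ.filter (fun i => k i = 3) = univ := by simp [h3]
      rw [huniv]
      have : k = fun _ => 3 := funext h3
      rw [this, card_univ, Fintype.card_fin]
    · push Not at h3
      obtain ⟨i, hi⟩ := h3
      have hi2 : k i = 2 := (hk i).resolve_right hi
      have hc : #{l | k l = 3} = #{l | (k ∘ i.succAbove) l = 3} := by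
        rw [card_filter, card_filter, Fin.sum_univ_succAbove _ i]
        simp [hi2]
      rw [(hMw.2.1 r hr k (fun l => by rcases hk l with h | h <;> lia) i hi2).2, hc]
      exact ih _ (fun l => hk _) (hc ▸ h2)

open Finset Classical in
/-- `w` dominates the total waste collected at points outside the cube `[2, 3]^r`, together with the
values of `w` at the points where a lattice path enters that cube. -/
theorem MwProps.sum_le_w {M w : ∀ r : ℕ, (Fin r → ℕ) → ℕ} (hMw : MwProps M w) {r : ℕ}
    (hr : 2 ≤ r) (q : Fin r → ℕ) (hq : ¬ q ≤ 1) :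
    ∑ p ∈ Iic q with ¬ p ≤ 1, ((#{i | 0 < p i} - 2) +
      ∑ i with 0 < p i, if p - Pi.single i 1 ≤ 1 then w r (p - Pi.single i 1 + 2) else 0) *
        Nat.multinomial univ (q - p) ≤ w r (q + 2) := by
  have key := sum_mul_multinomial_le (fun q => if q ≤ 1 then 0 else w r (q + 2))
    (fun p => if p ≤ 1 then 0 else (#{i | 0 < p i} - 2) +
      ∑ i with 0 < p i, if p - Pi.single i 1 ≤ 1 then w r (p - Pi.single i 1 + 2) else 0)
    (fun p => ?_) q
  · simp only [hq, if_false] at key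
    refine le_trans (le_of_eq ?_) key
    rw [sum_filter]
    refine sum_congr rfl fun p _ => ?_
    by_cases hp : p ≤ 1 <;> simp [hp]
  · by_cases hp : p ≤ 1
    · have : ∀ i, p - Pi.single i 1 ≤ 1 := fun i => tsub_le_self.trans hp
      simp [hp, this]
    · simp only [hp, if_false]
      rw [add_assoc, ← sum_add_distrib, hMw.w_eq_sum hr (p + 2) (fun i => by simp), add_comm]
      refine le_of_eq ?_
      simp only [Pi.add_apply, Pi.ofNat_apply, Nat.lt_add_left_iff_pos]
      congr 1
      refine sum_congr rfl fun i hi => ?_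
      have hi : 0 < p i := by simpa using hi
      have : Function.update (p + 2) i (p i + 2 - 1) = p - Pi.single i 1 + 2 := by
        ext l
        by_cases hl : l = i
        · subst hl
          simp only [Function.update_self, Pi.add_apply, Pi.sub_apply, Pi.single_eq_same,
            Pi.ofNat_apply]
          lia
        · simp [hl]
      rw [this]
      split_ifs <;> simp

open Finset in
theorem MwProps.le_w_diagonal {M w : ∀ r : ℕ, (Fin r → ℕ) → ℕ} (hMw : MwProps M w) {r K : ℕ}
    (hr : 2 ≤ r) (hK : 2 ≤ K) :
    ∑ i ∈ range (K - 1), ∑ s : Finset (Fin r) with 1 ≤ #s ∧ (i = K - 2 → 2 ≤ #s),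
        (r - 2) * (r.factorial ^ i * (r - #s).factorial) +
      ∑ J : Finset (Fin r) with #J < r - 2, ∑ l ∈ Jᶜ,
        ((r - #J - 2) + w (r - #J) (fun _ => 3)) *
          Nat.multinomial univ (fun m => if m ∈ J then K else if m = l then K - 2 else K - 1)
      ≤ w r (fun _ => K + 2) := by
  classical
  have hq : ¬ (fun _ : Fin r => K) ≤ 1 := by
    intro h
    have := h ⟨0, by lia⟩
    simp only [Pi.one_apply] at this
    lia
  have key := hMw.sum_le_w hr (fun _ => K) hq
  set F : (Fin r → ℕ) → ℕ := fun p => ((#{i | 0 < p i} - 2) +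
    ∑ i with 0 < p i, if p - Pi.single i 1 ≤ 1 then w r (p - Pi.single i 1 + 2) else 0) *
      Nat.multinomial univ ((fun _ => K) - p)
  refine le_trans ?_ key
  rw [sum_sigma', sum_sigma']
  set A := (range (K - 1)).sigma fun i =>
    univ.filter fun s : Finset (Fin r) => 1 ≤ #s ∧ (i = K - 2 → 2 ≤ #s) with hA
  set B := (univ.filter fun J : Finset (Fin r) => #J < r - 2).sigma fun J => Jᶜ with hB
  let a : (Σ _ : ℕ, Finset (Fin r)) → Fin r → ℕ :=
    fun x m => if m ∈ x.2 then K - x.1 else K - x.1 - 1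
  let b : (Σ _ : Finset (Fin r), Fin r) → Fin r → ℕ :=
    fun x m => if m ∈ x.1 then 0 else if m = x.2 then 2 else 1
  have hAmem : ∀ x ∈ A, x.1 + 2 ≤ K ∧ x.2.Nonempty ∧ (x.1 = K - 2 → 2 ≤ #x.2) := by
    intro x hx
    simp only [hA, mem_sigma, mem_range, mem_filter, mem_univ, true_and] at hx
    exact ⟨by lia, card_pos.mp hx.2.1, hx.2.2⟩
  have hBmem : ∀ x ∈ B, #x.1 < r - 2 ∧ x.2 ∉ x.1 := by
    intro x hx
    simpa [hB] using hx
  have hainj : Set.InjOn a A := by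
    rintro ⟨i, s⟩ hx ⟨i', s'⟩ hx' h
    obtain ⟨hi, ⟨m, hm⟩, -⟩ := hAmem _ hx
    obtain ⟨hi', ⟨m', hm'⟩, -⟩ := hAmem _ hx'
    simp only [a] at hi hi' hm hm' h
    have h1 := congrFun h m
    have h2 := congrFun h m'
    simp only [hm, hm', if_true] at h1 h2
    have hii : i = i' := by split_ifs at h1 h2 <;> lia
    subst hii
    congr 1
    ext l
    have h3 := congrFun h l
    split_ifs at h3 with h4 h5 h5 <;> lia
  have hbinj : Set.InjOn b B := by
    rintro ⟨J, l⟩ hx ⟨J', l'⟩ hx' h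
    have hl := (hBmem _ hx).2
    have hl' := (hBmem _ hx').2
    simp only at hl hl'
    have hJ : J = J' := by
      ext m
      have h3 := congrFun h m
      simp only [b] at h3
      split_ifs at h3 with h4 h5 h5 <;> lia
    subst hJ
    have h3 := congrFun h l
    simp only [b, hl, if_true, if_false] at h3
    split_ifs at h3 with h4
    · rw [h4]
    · lia
  have hdisj : Disjoint (A.image a) (B.image b) := by
    rw [disjoint_left]
    intro p hpA hpB
    obtain ⟨⟨i, s⟩, hx, rfl⟩ := mem_image.mp hpA
    obtain ⟨⟨J, l⟩, hy, h⟩ := mem_image.mp hpB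
    obtain ⟨hi, ⟨m, hm⟩, hs⟩ := hAmem _ hx
    obtain ⟨hJ, hl⟩ := hBmem _ hy
    simp only at hi hm hs hJ hl
    have hex : ∃ m, m ∉ insert l J := by
      by_contra! hc
      have h1 : insert l J = univ := eq_univ_iff_forall.mpr hc
      have h2 := card_insert_le l J
      rw [h1, card_univ, Fintype.card_fin] at h2
      lia
    obtain ⟨n, hn⟩ := hex
    simp only [mem_insert, not_or] at hn
    have h1 := congrFun h n
    have h2 := congrFun h l
    simp only [a, b, hn, hl, if_true, if_false] at h1 h2
    have hiK : i = K - 2 := by split_ifs at h1 <;> lia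
    have hsub : s ⊆ {l} := by
      intro m hm
      have h3 := congrFun h m
      simp only [a, b, hm, if_true] at h3
      rw [mem_singleton]
      by_contra hml
      split_ifs at h3 <;> lia
    have := card_le_card hsub
    have := hs hiK
    simp only [card_singleton] at *
    lia
  have hsubset : A.image a ∪ B.image b ⊆ (Iic fun _ => K).filter fun p => ¬ p ≤ 1 := by
    intro p hp
    rw [mem_filter, mem_Iic]
    rcases mem_union.mp hp with hp | hp
    · obtain ⟨⟨i, s⟩, hx, rfl⟩ := mem_image.mp hp
      obtain ⟨hi, ⟨m, hm⟩, hs⟩ := hAmem _ hx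
      simp only at hi hm
      refine ⟨fun n => ?_, fun h => ?_⟩
      · simp only [a]
        split_ifs <;> lia
      · have := h m
        simp only [a, hm, if_true, Pi.one_apply] at this
        lia
    · obtain ⟨⟨J, l⟩, hy, rfl⟩ := mem_image.mp hp
      obtain ⟨hJ, hl⟩ := hBmem _ hy
      simp only at hl
      refine ⟨fun n => ?_, fun h => ?_⟩
      · simp only [b]
        split_ifs <;> lia
      · have := h l
        simp [b, hl] at this
  refine le_trans ?_ (sum_le_sum_of_subset hsubset)
  rw [sum_union hdisj, sum_image hainj, sum_image hbinj]
  refine add_le_add (sum_le_sum fun x hx => ?_) (sum_le_sum fun x hx => ?_)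
  · obtain ⟨i, s⟩ := x
    obtain ⟨hi, -, -⟩ := hAmem _ hx
    simp only at hi
    have hpos : univ.filter (fun m => 0 < a ⟨i, s⟩ m) = univ := by
      rw [filter_eq_self]
      intro m _
      simp only [a]
      split_ifs <;> lia
    have hsub : (fun _ => K) - a ⟨i, s⟩ = fun l => if l ∈ s then i else i + 1 := by
      ext m
      simp only [a, Pi.sub_apply]
      split_ifs <;> lia
    simp only
    rw [hpos, hsub, card_univ, Fintype.card_fin]
    refine Nat.mul_le_mul (Nat.le_add_right _ _) ?_
    simpa using factorial_pow_mul_factorial_le_multinomial i s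
  · obtain ⟨J, l⟩ := x
    obtain ⟨hJ, hl⟩ := hBmem _ hx
    simp only at hJ hl
    have hpos : univ.filter (fun m => 0 < b ⟨J, l⟩ m) = Jᶜ := by
      ext m
      simp only [b, mem_filter, mem_univ, true_and, mem_compl]
      split_ifs with h1 <;> simp [h1]
    have hsub : (fun _ => K) - b ⟨J, l⟩ =
        fun m => if m ∈ J then K else if m = l then K - 2 else K - 1 := by
      ext m
      simp only [b, Pi.sub_apply]
      split_ifs <;> lia
    have hstep : ∀ m, (b ⟨J, l⟩ - Pi.single l 1 : Fin r → ℕ) m = if m ∈ J then 0 else 1 := by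
      intro m
      by_cases hm : m = l
      · subst hm
        simp [b, hl]
      · simp [b, hm]
    have hle : b ⟨J, l⟩ - Pi.single l 1 ≤ 1 := by
      intro m
      rw [hstep]
      split_ifs <;> simp
    have hcard : #{m | (b ⟨J, l⟩ - Pi.single l 1 + 2 : Fin r → ℕ) m = 3} = r - #J := by
      have h1 : univ.filter (fun m => (b ⟨J, l⟩ - Pi.single l 1 + 2 : Fin r → ℕ) m = 3) = Jᶜ := by
        ext m
        rw [mem_filter, Pi.add_apply, hstep, mem_compl]
        by_cases hm : m ∈ J <;> simp [hm]
      rw [h1, card_compl, Fintype.card_fin]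
    have hw : w r (b ⟨J, l⟩ - Pi.single l 1 + 2) = w (r - #J) (fun _ => 3) := by
      rw [hMw.w_eq_w_three hr, hcard]
      · intro m
        rw [Pi.add_apply, hstep]
        by_cases hm : m ∈ J <;> simp [hm]
      · rw [hcard]
        lia
    simp only
    rw [hpos, hsub, card_compl, Fintype.card_fin]
    gcongr
    refine le_trans (le_of_eq ?_) (single_le_sum (fun _ _ => Nat.zero_le _) (mem_compl.mpr hl))
    rw [if_pos hle, hw]

open Finset in
theorem sum_factorial_card_sub_card {r : ℕ} (hr : 1 ≤ r) (c : Prop) [Decidable c] :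
    ∑ s : Finset (Fin r) with 1 ≤ #s ∧ (c → 2 ≤ #s), ((r - #s).factorial : ℝ) =
      r.factorial * ((∑ n ∈ range (r + 1), (1 : ℝ) / n.factorial) - 1 - if c then 1 else 0) := by
  obtain ⟨t, rfl⟩ := Nat.exists_eq_add_of_le' hr
  have h1 := sum_powerset_apply_card
    (fun m => if 1 ≤ m ∧ (c → 2 ≤ m) then ((t + 1 - m).factorial : ℝ) else 0)
    (x := (univ : Finset (Fin (t + 1))))
  rw [powerset_univ, card_univ, Fintype.card_fin] at h1
  rw [sum_filter, h1]
  have h2 : ∀ m ∈ range (t + 1 + 1),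
      ((t + 1).choose m • if 1 ≤ m ∧ (c → 2 ≤ m) then ((t + 1 - m).factorial : ℝ) else 0) =
        if 1 ≤ m ∧ (c → 2 ≤ m) then (t + 1).factorial * ((1 : ℝ) / m.factorial) else 0 := by
    intro m hm
    have hm : m ≤ t + 1 := Nat.lt_succ_iff.mp (mem_range.mp hm)
    split_ifs
    · have := Nat.choose_mul_factorial_mul_factorial hm
      rw [nsmul_eq_mul, ← this]
      push_cast
      field_simp
    · simp
  rw [sum_congr rfl h2, sum_range_succ', sum_range_succ', sum_range_succ' _ (t + 1),
    sum_range_succ' _ t]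
  by_cases hc : c <;> simp [hc, mul_sum, mul_add]

theorem stmt_14 (M w : ∀ r : ℕ, (Fin r → ℕ) → ℕ) (hMw : MwProps M w)
    (r k : ℕ) (hr : 2 ≤ r) (hk : 4 ≤ k) :
    ((r : ℝ) - 2) * r.factorial *
        (((∑ n ∈ Finset.range (r + 1), (1 : ℝ) / n.factorial) - 1) *
            (∑ i ∈ Finset.range (k - 3), (r.factorial : ℝ) ^ i) -
          (r.factorial : ℝ) ^ (k - 4)) +
      ∑ j ∈ Finset.range (r - 2),
        (r.choose j : ℝ) *
          (Nat.multinomial Finset.univ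
            (fun l : Fin r =>
              if (l : ℕ) < j then k - 2 else if (l : ℕ) < r - 1 then k - 3 else k - 4) : ℝ) *
          ((r : ℝ) - j) * (((r : ℝ) - j - 2) + (w (r - j) (fun _ => 3) : ℝ))
      ≤ (w r (fun _ => k) : ℝ) := by
  obtain ⟨K, rfl⟩ := Nat.exists_eq_add_of_le' (show 2 ≤ k by lia)
  have hK : 2 ≤ K := by lia
  have key : ((_ : ℕ) : ℝ) ≤ _ := Nat.cast_le.mpr (hMw.le_w_diagonal hr hK)
  refine le_trans (le_of_eq ?_) key
  rw [Nat.cast_add]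
  congr 1
  · push_cast [Nat.cast_sub hr]
    simp_rw [← Finset.mul_sum, sum_factorial_card_sub_card (by lia : 1 ≤ r)]
    have h1 : ∑ i ∈ Finset.range (K - 1), (r.factorial : ℝ) ^ i * (if i = K - 2 then 1 else 0) =
        (r.factorial : ℝ) ^ (K - 2) := by
      simp only [mul_ite, mul_one, mul_zero, Finset.sum_ite_eq', Finset.mem_range]
      exact if_pos (by lia)
    rw [← h1, Finset.mul_sum,
      ← Finset.sum_sub_distrib, mul_assoc, Finset.mul_sum]
    congr 1
    exact Finset.sum_congr rfl fun i _ => by ring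
  · have hlast : r - 1 < r := by lia
    have h1 : ∀ J ∈ Finset.univ.filter (fun J : Finset (Fin r) => J.card < r - 2),
        ∑ l ∈ Jᶜ, ((r - J.card - 2) + w (r - J.card) (fun _ => 3)) *
          Nat.multinomial Finset.univ
            (fun m => if m ∈ J then K else if m = l then K - 2 else K - 1) =
        (r - J.card) * (((r - J.card - 2) + w (r - J.card) (fun _ => 3)) *
          Nat.multinomial Finset.univ (fun l : Fin r =>
            if (l : ℕ) < J.card then K else if (l : ℕ) < r - 1 then K - 1 else K - 2)) := by
      intro J hJ
      have hJ : J.card < r - 2 := by simpa using hJ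
      have h2 : ∀ l ∈ Jᶜ, Nat.multinomial Finset.univ
            (fun m => if m ∈ J then K else if m = l then K - 2 else K - 1) =
          Nat.multinomial Finset.univ (fun l : Fin r =>
            if (l : ℕ) < J.card then K else if (l : ℕ) < r - 1 then K - 1 else K - 2) := by
        intro l hl
        have hcard : (Finset.univ.filter fun m : Fin r => (m : ℕ) < J.card).card = J.card := by
          rw [Fin.card_filter_val_lt]
          lia
        rw [multinomial_ite_congr (J' := Finset.univ.filter fun m : Fin r => (m : ℕ) < J.card)
          (l' := ⟨r - 1, hlast⟩) (Finset.mem_compl.mp hl) _ hcard.symm]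
        · congr 1
          ext m
          simp only [Finset.mem_filter, Finset.mem_univ, true_and, Fin.ext_iff]
          split_ifs <;> lia
        · simp only [Finset.mem_filter, Finset.mem_univ, true_and]
          lia
      rw [Finset.sum_congr rfl fun l hl => by rw [h2 l hl], Finset.sum_const, Finset.card_compl,
        Fintype.card_fin, smul_eq_mul]
    rw [Finset.sum_congr rfl h1, Finset.sum_filter]
    have h3 := Finset.sum_powerset_apply_card
      (fun j => if j < r - 2 then (r - j) * (((r - j - 2) + w (r - j) (fun _ => 3)) *
          Nat.multinomial Finset.univ (fun l : Fin r =>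
            if (l : ℕ) < j then K else if (l : ℕ) < r - 1 then K - 1 else K - 2)) else 0)
      (x := (Finset.univ : Finset (Fin r)))
    rw [Finset.powerset_univ, Finset.card_univ, Fintype.card_fin] at h3
    rw [h3, Nat.cast_sum]
    refine Finset.sum_subset_zero_on_sdiff (fun j => ?_) (fun j hj => ?_) (fun j hj => ?_)
    · simp only [Finset.mem_range]
      lia
    · simp only [Finset.mem_sdiff, Finset.mem_range] at hj
      simp [hj.2]
    · have hj : j < r - 2 := Finset.mem_range.mp hj
      rw [if_pos hj, show K + 2 - 2 = K by lia, show K + 2 - 3 = K - 1 by lia,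
        show K + 2 - 4 = K - 2 by lia, smul_eq_mul]
      push_cast [Nat.cast_sub (show j ≤ r by lia), Nat.cast_sub (show 2 ≤ r - j by lia)]
      ring
end
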